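/- Let f : (0,∞) → ℂ be locally absolutely continuous, of bounded variation on (0,∞), with lim_{t→∞} f(t) = 0 (so that f' is Lebesgue integrable on (0,∞)). Then for every x > 0, H_0(T_{f'})(x) = (2/(xπ)) ∫_0^∞ f'(t) sin(xt) (∫_{xt}^∞ (cos v)/v dv) dt + (2/(xπ)) ∫_0^∞ f'(t) cos(xt) (∫_0^{xt} (sin v)/v dv) dt. -/

import Mathlib

open MeasureTheory Filter Set Real

/-- The sine integral function. -/
noncomputable def sinIntegral (y : ℝ) : ℝ := ∫ v in (0 : ℝ)..y, sin v / v

theorem abs_intervalIntegral_div_le {F g : ℝ → ℝ} (hF : ∀ v, HasDerivAt F (g v) v)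
    (hg : Continuous g) (hb : ∀ v, |F v| ≤ 1) {a b : ℝ} (ha : 0 < a) (hab : a ≤ b) :
    |∫ v in a..b, g v / v| ≤ 2 / a := by
  have hpos : ∀ v ∈ uIcc a b, 0 < v := fun v hv => by
    rw [uIcc_of_le hab] at hv; exact ha.trans_le hv.1
  have hFc : Continuous F := continuous_iff_continuousAt.2 fun v => (hF v).continuousAt
  have hinv : ContinuousOn (fun v : ℝ => -(v ^ 2)⁻¹) (uIcc a b) := by
    refine (ContinuousOn.inv₀ (by fun_prop) fun v hv => ?_).neg
    exact pow_ne_zero _ (hpos v hv).ne'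
  have hparts := intervalIntegral.integral_mul_deriv_eq_deriv_mul (a := a) (b := b)
    (u := fun v : ℝ => v⁻¹) (v := F) (u' := fun v => -(v ^ 2)⁻¹) (v' := g)
    (fun v hv => hasDerivAt_inv (hpos v hv).ne') (fun v _ => hF v)
    hinv.intervalIntegrable (hg.intervalIntegrable _ _)
  have hsq : ∫ v in a..b, -(v ^ 2)⁻¹ = b⁻¹ - a⁻¹ :=
    intervalIntegral.integral_eq_sub_of_hasDerivAt
      (fun v hv => hasDerivAt_inv (hpos v hv).ne') hinv.intervalIntegrable
  have hrest : |∫ v in a..b, -(v ^ 2)⁻¹ * F v| ≤ a⁻¹ - b⁻¹ := by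
    have hle : ‖∫ v in a..b, -(v ^ 2)⁻¹ * F v‖ ≤ ∫ v in a..b, -(-(v ^ 2)⁻¹) := by
      refine intervalIntegral.norm_integral_le_of_norm_le hab (ae_of_all _ fun v _ => ?_)
        hinv.intervalIntegrable.neg
      rw [norm_mul, norm_neg, norm_inv, norm_pow, Real.norm_eq_abs, sq_abs, neg_neg]
      exact mul_le_of_le_one_right (by positivity) (hb v)
    rw [intervalIntegral.integral_neg, hsq] at hle
    rw [← Real.norm_eq_abs]
    linarith
  have hb0 : 0 < b := ha.trans_le hab
  have hend : ∀ c : ℝ, 0 < c → |c⁻¹ * F c| ≤ c⁻¹ := fun c hc => by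
    rw [abs_mul, abs_of_pos (inv_pos.2 hc)]
    exact mul_le_of_le_one_right (by positivity) (hb c)
  have heq : ∫ v in a..b, g v / v = ∫ v in a..b, v⁻¹ * g v := by
    simp only [div_eq_inv_mul]
  rw [heq, hparts, div_eq_mul_inv]
  have h1 := abs_le.1 (hend a ha)
  have h2 := abs_le.1 (hend b hb0)
  have h3 := abs_le.1 hrest
  rw [abs_le]
  constructor <;> linarith [h1.1, h1.2, h2.1, h2.2, h3.1, h3.2]

theorem abs_intervalIntegral_sin_div_le {a b : ℝ} (ha : 0 < a) (hab : a ≤ b) :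
    |∫ v in a..b, sin v / v| ≤ 2 / a :=
  abs_intervalIntegral_div_le (F := fun v => -cos v)
    (fun v => by simpa using (hasDerivAt_cos v).fun_neg) continuous_sin
    (fun v => by rw [abs_neg]; exact abs_cos_le_one v) ha hab

theorem abs_intervalIntegral_cos_div_le {a b : ℝ} (ha : 0 < a) (hab : a ≤ b) :
    |∫ v in a..b, cos v / v| ≤ 2 / a :=
  abs_intervalIntegral_div_le hasDerivAt_sin continuous_cos abs_sin_le_one ha hab

theorem intervalIntegrable_sin_div (a b : ℝ) :
    IntervalIntegrable (fun v => sin v / v) volume a b := by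
  refine (continuous_sinc.intervalIntegrable a b).congr_ae ?_
  have h0 : ∀ᵐ v : ℝ, v ≠ 0 := by simp [ae_iff]
  filter_upwards [ae_restrict_of_ae h0] with v hv
  rw [sinc_of_ne_zero hv]

theorem intervalIntegrable_cos_div {a b : ℝ} (h : (0 : ℝ) ∉ uIcc a b) :
    IntervalIntegrable (fun v => cos v / v) volume a b :=
  (continuous_cos.continuousOn.div continuousOn_id fun v hv h0 =>
    h (by simp only [id] at h0; rwa [h0] at hv)).intervalIntegrable

theorem zero_notMem_uIcc {a b : ℝ} (ha : 0 < a) (hb : 0 < b) : (0 : ℝ) ∉ uIcc a b :=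
  fun h => (lt_min ha hb).not_ge h.1

theorem continuous_sinIntegral : Continuous sinIntegral :=
  intervalIntegral.continuous_primitive intervalIntegrable_sin_div 0

theorem sinIntegral_sub (a b : ℝ) :
    ∫ v in a..b, sin v / v = sinIntegral b - sinIntegral a :=
  (intervalIntegral.integral_interval_sub_left (intervalIntegrable_sin_div _ _)
    (intervalIntegrable_sin_div _ _)).symm

theorem sinIntegral_neg (y : ℝ) : sinIntegral (-y) = -sinIntegral y := by
  have h := intervalIntegral.integral_comp_neg (a := 0) (b := y) fun v => sin v / v
  simp only [sin_neg, neg_div_neg_eq, neg_zero] at h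
  rw [sinIntegral, sinIntegral, h, intervalIntegral.integral_symm]

theorem abs_sinIntegral_le {y : ℝ} (hy : 0 ≤ y) : |sinIntegral y| ≤ 3 := by
  have hsmall : ∀ z : ℝ, 0 ≤ z → |sinIntegral z| ≤ z := fun z hz => by
    have h := intervalIntegral.norm_integral_le_of_norm_le_const (a := 0) (b := z) (C := 1)
      (f := fun v => sin v / v) fun v _ => by
        rw [norm_div]
        exact div_le_one_of_le₀ abs_sin_le_abs (abs_nonneg v)
    simpa [abs_of_nonneg hz, sinIntegral] using h
  rcases le_total y 1 with h | h
  · linarith [hsmall y hy]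
  · have h1 := abs_intervalIntegral_sin_div_le one_pos h
    rw [sinIntegral_sub] at h1
    have h2 := abs_add_le (sinIntegral y - sinIntegral 1) (sinIntegral 1)
    rw [sub_add_cancel] at h2
    linarith [hsmall 1 zero_le_one]

/-- `c u` is the improper integral `∫_u^∞ cos v / v dv` for every `u > 0`. -/
def IsCosTail (c : ℝ → ℝ) : Prop :=
  ∀ u : ℝ, 0 < u → Tendsto (fun A : ℝ => ∫ v in u..A, cos v / v) atTop (nhds (c u))

theorem cosTail_sub {coTail : ℝ → ℝ} (hcoTail : IsCosTail coTail)
    {a b : ℝ} (ha : 0 < a) (hb : 0 < b) :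
    ∫ v in a..b, cos v / v = coTail a - coTail b := by
  refine tendsto_nhds_unique (tendsto_const_nhds.congr' ?_) ((hcoTail a ha).sub (hcoTail b hb))
  filter_upwards [eventually_gt_atTop 0] with A hA
  rw [← intervalIntegral.integral_add_adjacent_intervals (b := b)
    (intervalIntegrable_cos_div (zero_notMem_uIcc ha hb))
    (intervalIntegrable_cos_div (zero_notMem_uIcc hb hA)), add_sub_cancel_right]

theorem abs_cosTail_le {coTail : ℝ → ℝ} (hcoTail : IsCosTail coTail)
    {a : ℝ} (ha : 0 < a) : |coTail a| ≤ 2 / a := by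
  refine le_of_tendsto (hcoTail a ha).abs ?_
  filter_upwards [eventually_ge_atTop a] with A hA
  exact abs_intervalIntegral_cos_div_le ha hA

theorem continuousOn_cosTail {coTail : ℝ → ℝ} (hcoTail : IsCosTail coTail) :
    ContinuousOn coTail (Ioi 0) := by
  intro a ha
  have ha : 0 < a := ha
  refine ContinuousAt.continuousWithinAt ?_
  have hd : HasDerivAt (fun b => ∫ v in a..b, cos v / v) (cos a / a) a := by
    refine intervalIntegral.integral_hasDerivAt_right (by simp) ?_ ?_
    · exact (Measurable.stronglyMeasurable (by fun_prop)).stronglyMeasurableAtFilter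
    · exact continuous_cos.continuousAt.div continuousAt_id ha.ne'
  have hc : ContinuousAt (fun b => coTail a - ∫ v in a..b, cos v / v) a :=
    continuousAt_const.sub hd.continuousAt
  refine hc.congr ?_
  filter_upwards [lt_mem_nhds ha] with b hb
  rw [cosTail_sub hcoTail ha hb, sub_sub_cancel]

theorem intervalIntegral_sin_mul_div_sub {p q u y : ℝ} (hu : 0 < u) (hy : y ∉ uIcc p q) :
    ∫ t in p..q, sin (t * u) / (t - y) =
      cos (y * u) * (∫ v in ((p - y) * u)..((q - y) * u), sin v / v) +
        sin (y * u) * ∫ v in ((p - y) * u)..((q - y) * u), cos v / v := by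
  have h0 : (0 : ℝ) ∉ uIcc ((p - y) * u) ((q - y) * u) := by
    intro h
    apply hy
    rw [mem_uIcc] at h ⊢
    rcases h with h | h
    · left; constructor <;> nlinarith [h.1, h.2]
    · right; constructor <;> nlinarith [h.1, h.2]
  have hsub := intervalIntegral.integral_comp_mul_sub (a := p) (b := q)
    (fun v => u * (sin (v + y * u) / v)) hu.ne' (u * y)
  have hL : ∫ t in p..q, sin (t * u) / (t - y) =
      ∫ t in p..q, u * (sin (u * t - u * y + y * u) / (u * t - u * y)) := by
    congr 1 with t
    rw [show u * t - u * y + y * u = t * u by ring, ← mul_sub, ← mul_div_assoc,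
      mul_div_mul_left _ _ hu.ne']
  rw [hL, hsub, intervalIntegral.integral_const_mul, smul_eq_mul, inv_mul_cancel_left₀ hu.ne',
    ← intervalIntegral.integral_const_mul, ← intervalIntegral.integral_const_mul,
    ← intervalIntegral.integral_add ((intervalIntegrable_sin_div _ _).const_mul _)
      ((intervalIntegrable_cos_div h0).const_mul _),
    show u * p - u * y = (p - y) * u by ring, show u * q - u * y = (q - y) * u by ring]
  congr 1 with v
  rw [sin_add]
  ring

theorem intervalIntegral_sin_mul_div_sq_sub_sq {p q u x : ℝ} (hu : 0 < u) (hx : 0 < x)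
    (hxm : x ∉ uIcc p q) (hxn : -x ∉ uIcc p q) :
    ∫ t in p..q, sin (t * u) / (t ^ 2 - x ^ 2) = (2 * x)⁻¹ *
      (cos (x * u) * ((∫ v in ((p - x) * u)..((q - x) * u), sin v / v) -
          ∫ v in ((p + x) * u)..((q + x) * u), sin v / v) +
        sin (x * u) * ((∫ v in ((p - x) * u)..((q - x) * u), cos v / v) +
          ∫ v in ((p + x) * u)..((q + x) * u), cos v / v)) := by
  have hi : ∀ y : ℝ, y ∉ uIcc p q →
      IntervalIntegrable (fun t => sin (t * u) / (t - y)) volume p q := fun y hy =>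
    (ContinuousOn.div (by fun_prop) (by fun_prop) fun t ht h0 =>
      hy (by rwa [← sub_eq_zero.1 h0])).intervalIntegrable
  have h1 := intervalIntegral_sin_mul_div_sub hu hxm
  have h2 := intervalIntegral_sin_mul_div_sub hu hxn
  have hL : ∫ t in p..q, sin (t * u) / (t ^ 2 - x ^ 2) =
      ∫ t in p..q, (2 * x)⁻¹ * (sin (t * u) / (t - x) - sin (t * u) / (t - -x)) := by
    refine intervalIntegral.integral_congr fun t ht => ?_
    have ha : t - x ≠ 0 := fun h => hxm (by rwa [← sub_eq_zero.1 h])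
    have hb : t + x ≠ 0 := fun h => hxn (by rwa [← eq_neg_of_add_eq_zero_left h])
    have hc : t ^ 2 - x ^ 2 = (t - x) * (t + x) := by ring
    simp only [sub_neg_eq_add, hc]
    field_simp
    ring
  rw [hL, intervalIntegral.integral_const_mul, intervalIntegral.integral_sub (hi x hxm)
    (hi (-x) hxn), h1, h2]
  simp only [sub_neg_eq_add, neg_mul, cos_neg, sin_neg]
  ring

theorem setOf_pos_and_lt_abs_sub {x δ : ℝ} (hδ : 0 < δ) (hδx : δ < x) :
    {t : ℝ | 0 < t ∧ δ < |t - x|} = Ioo 0 (x - δ) ∪ Ioi (x + δ) := by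
  ext t
  simp only [mem_ofPred_eq, lt_abs, mem_union, mem_Ioo, mem_Ioi]
  constructor
  · rintro ⟨h0, h | h⟩
    · right; linarith
    · left; constructor <;> linarith
  · rintro (⟨h0, h⟩ | h)
    · exact ⟨h0, Or.inr (by linarith)⟩
    · exact ⟨by linarith, Or.inl (by linarith)⟩

theorem integrableOn_inv_sq_sub_sq_Ioo {x δ : ℝ} (hδ : 0 < δ) (hδx : δ < x) :
    IntegrableOn (fun t : ℝ => (t ^ 2 - x ^ 2)⁻¹) (Ioo 0 (x - δ)) := by
  have hc : ContinuousOn (fun t : ℝ => (t ^ 2 - x ^ 2)⁻¹) (Icc 0 (x - δ)) :=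
    ContinuousOn.inv₀ (by fun_prop) fun t ht => by nlinarith [ht.1, ht.2]
  exact hc.integrableOn_Icc.mono_set Ioo_subset_Icc_self

theorem integrableOn_inv_sq_sub_sq_Ioi {x δ : ℝ} (hδ : 0 < δ) (hx : 0 < x) :
    IntegrableOn (fun t : ℝ => (t ^ 2 - x ^ 2)⁻¹) (Ioi (x + δ)) := by
  have hr : IntegrableOn (fun t : ℝ => (t + -x) ^ (-2 : ℝ)) (Ioi (x + δ)) :=
    integrableOn_add_rpow_Ioi_of_lt (by norm_num) (by linarith)
  refine Integrable.mono' hr (Measurable.aestronglyMeasurable (by fun_prop)) ?_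
  filter_upwards [ae_restrict_mem measurableSet_Ioi] with t ht
  have ht : x + δ < t := ht
  have h1 : 0 < t + -x := by linarith
  have h2 : (t + -x) ^ 2 ≤ t ^ 2 - x ^ 2 := by nlinarith
  rw [rpow_neg h1.le, rpow_two, norm_inv, Real.norm_of_nonneg ((sq_nonneg _).trans h2)]
  exact inv_anti₀ (by positivity) h2

/-- The truncated kernel `∫ sin (t u) / (t² - x²) dt` over `t > 0`, `|t - x| > δ`. -/
noncomputable def truncatedKernel (x δ u : ℝ) : ℝ :=
  ∫ t in {t : ℝ | 0 < t ∧ δ < |t - x|}, sin (t * u) * (t ^ 2 - x ^ 2)⁻¹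

theorem integrableOn_inv_sq_sub_sq {x δ : ℝ} (hδ : 0 < δ) (hδx : δ < x) :
    IntegrableOn (fun t : ℝ => (t ^ 2 - x ^ 2)⁻¹) {t : ℝ | 0 < t ∧ δ < |t - x|} := by
  rw [setOf_pos_and_lt_abs_sub hδ hδx]
  exact (integrableOn_inv_sq_sub_sq_Ioo hδ hδx).union
    (integrableOn_inv_sq_sub_sq_Ioi hδ (hδ.trans hδx))

theorem integrable_sin_mul {μ : Measure ℝ} {g : ℝ → ℝ} (hg : Integrable g μ) (u : ℝ) :
    Integrable (fun t => sin (t * u) * g t) μ :=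
  hg.bdd_mul (c := 1) (Measurable.aestronglyMeasurable (by fun_prop))
    (ae_of_all _ fun t => abs_sin_le_one _)

theorem truncatedKernel_eq {coTail : ℝ → ℝ} (hcoTail : IsCosTail coTail) {x δ u : ℝ}
    (hδ : 0 < δ) (hδx : δ < x) (hu : 0 < u) :
    truncatedKernel x δ u = (2 * x)⁻¹ *
      (cos (x * u) * (2 * sinIntegral (x * u) - 2 * sinIntegral (δ * u) +
          sinIntegral ((2 * x + δ) * u) - sinIntegral ((2 * x - δ) * u)) +
        sin (x * u) * (2 * coTail (x * u) + coTail ((2 * x + δ) * u) -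
          coTail ((2 * x - δ) * u))) := by
  have hx : 0 < x := hδ.trans hδx
  have hxu : 0 < x * u := mul_pos hx hu
  have hδu : 0 < δ * u := mul_pos hδ hu
  have hp : 0 < (2 * x + δ) * u := mul_pos (by linarith) hu
  have hm : 0 < (2 * x - δ) * u := mul_pos (by linarith) hu
  have hleft : ∫ t in Ioo 0 (x - δ), sin (t * u) * (t ^ 2 - x ^ 2)⁻¹ = (2 * x)⁻¹ *
      (cos (x * u) * (2 * sinIntegral (x * u) - sinIntegral (δ * u) -
          sinIntegral ((2 * x - δ) * u)) +
        sin (x * u) * (2 * coTail (x * u) - coTail (δ * u) -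
          coTail ((2 * x - δ) * u))) := by
    have hsub : (0 : ℝ) ≤ x - δ := by linarith
    have hneg : ∫ v in (-(x * u))..(-(δ * u)), cos v / v = coTail (x * u) - coTail (δ * u) := by
      have h := intervalIntegral.integral_comp_neg (a := δ * u) (b := x * u)
        fun v => cos v / v
      rw [← h, ← cosTail_sub hcoTail hxu hδu, intervalIntegral.integral_symm (δ * u) (x * u),
        ← intervalIntegral.integral_neg]
      simp only [cos_neg, div_neg]
    have h := intervalIntegral_sin_mul_div_sq_sub_sq (p := 0) (q := x - δ) hu hx
      (fun h => by rw [uIcc_of_le hsub] at h; linarith [h.2])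
      (fun h => by rw [uIcc_of_le hsub] at h; linarith [h.1])
    rw [show (0 - x) * u = -(x * u) by ring, show (x - δ - x) * u = -(δ * u) by ring,
      show (0 + x) * u = x * u by ring, show (x - δ + x) * u = (2 * x - δ) * u by ring,
      hneg, cosTail_sub hcoTail hxu hm, sinIntegral_sub, sinIntegral_sub, sinIntegral_neg,
      sinIntegral_neg] at h
    simp only [← div_eq_mul_inv (sin _)]
    rw [← integral_Ioc_eq_integral_Ioo, ← intervalIntegral.integral_of_le hsub, h]
    ring
  have hright : ∫ t in Ioi (x + δ), sin (t * u) * (t ^ 2 - x ^ 2)⁻¹ = (2 * x)⁻¹ *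
      (cos (x * u) * (sinIntegral ((2 * x + δ) * u) - sinIntegral (δ * u)) +
        sin (x * u) * (coTail (δ * u) + coTail ((2 * x + δ) * u))) := by
    have hint := integrable_sin_mul (integrableOn_inv_sq_sub_sq_Ioi hδ hx) u
    refine tendsto_nhds_unique (intervalIntegral_tendsto_integral_Ioi _ hint tendsto_id) ?_
    have hAm : Tendsto (fun A : ℝ => (A - x) * u) atTop atTop :=
      (tendsto_atTop_add_const_right _ (-x) tendsto_id).atTop_mul_const hu
    have hAp : Tendsto (fun A : ℝ => (A + x) * u) atTop atTop :=
      (tendsto_atTop_add_const_right _ x tendsto_id).atTop_mul_const hu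
    have hS : Tendsto (fun A : ℝ => ∫ v in ((A - x) * u)..((A + x) * u), sin v / v)
        atTop (nhds 0) := by
      refine squeeze_zero_norm' ?_ (tendsto_const_nhds (x := (2 : ℝ)).div_atTop hAm)
      filter_upwards [hAm.eventually_gt_atTop 0] with A hA
      exact abs_intervalIntegral_sin_div_le hA (by nlinarith)
    have hlim := ((((tendsto_const_nhds
      (x := sinIntegral ((2 * x + δ) * u) - sinIntegral (δ * u))).sub hS).const_mul
        (cos (x * u))).add ((((hcoTail _ hδu).comp hAm).add
          ((hcoTail _ hp).comp hAp)).const_mul (sin (x * u)))).const_mul (2 * x)⁻¹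
    rw [sub_zero] at hlim
    refine hlim.congr' ?_
    filter_upwards [eventually_ge_atTop (x + δ)] with A hA
    have h := intervalIntegral_sin_mul_div_sq_sub_sq (p := x + δ) (q := A) hu hx
      (fun h => by rw [uIcc_of_le hA] at h; linarith [h.1])
      (fun h => by rw [uIcc_of_le hA] at h; linarith [h.1])
    simp only [← div_eq_mul_inv (sin _), id, Function.comp]
    rw [h, show (x + δ - x) * u = δ * u by ring,
      show (x + δ + x) * u = (2 * x + δ) * u by ring, sinIntegral_sub, sinIntegral_sub,
      sinIntegral_sub]
    ring
  have hdisj : Disjoint (Ioo 0 (x - δ)) (Ioi (x + δ)) :=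
    Set.disjoint_left.2 fun t ht ht' => by
      have h1 := ht.2
      have h2 : x + δ < t := ht'
      linarith
  rw [truncatedKernel, setOf_pos_and_lt_abs_sub hδ hδx,
    setIntegral_union hdisj measurableSet_Ioi
      (integrable_sin_mul (integrableOn_inv_sq_sub_sq_Ioo hδ hδx) u)
      (integrable_sin_mul (integrableOn_inv_sq_sub_sq_Ioi hδ hx) u), hleft, hright]
  ring

theorem abs_sin_mul_cosTail_le {coTail : ℝ → ℝ} (hcoTail : IsCosTail coTail) {u v : ℝ}
    (hu : 0 < u) (huv : u ≤ v) : |sin u * coTail v| ≤ 2 := by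
  have h1 : |sin u| ≤ v := (abs_sin_le_abs.trans_eq (abs_of_pos hu)).trans huv
  have hv : 0 < v := hu.trans_le huv
  calc |sin u * coTail v| = |sin u| * |coTail v| := abs_mul _ _
    _ ≤ v * (2 / v) := mul_le_mul h1 (abs_cosTail_le hcoTail hv) (abs_nonneg _) hv.le
    _ = 2 := mul_div_cancel₀ _ hv.ne'

theorem abs_cos_mul_sinIntegral_le (u : ℝ) {v : ℝ} (hv : 0 ≤ v) :
    |cos u * sinIntegral v| ≤ 3 := by
  rw [abs_mul]
  exact (mul_le_of_le_one_left (abs_nonneg _) (abs_cos_le_one u)).trans (abs_sinIntegral_le hv)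

theorem abs_truncatedKernel_le {coTail : ℝ → ℝ} (hcoTail : IsCosTail coTail) {x δ u : ℝ}
    (hδ : 0 < δ) (hδx : δ < x) (hu : 0 < u) : |truncatedKernel x δ u| ≤ (2 * x)⁻¹ * 26 := by
  have hx : 0 < x := hδ.trans hδx
  have hxu : 0 < x * u := mul_pos hx hu
  rw [truncatedKernel_eq hcoTail hδ hδx hu, abs_mul, abs_of_pos (a := (2 * x)⁻¹) (by positivity)]
  refine mul_le_mul_of_nonneg_left ?_ (by positivity)
  have s1 := abs_le.1 (abs_cos_mul_sinIntegral_le (x * u) hxu.le)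
  have s2 := abs_le.1 (abs_cos_mul_sinIntegral_le (x * u) (mul_pos hδ hu).le)
  have s3 := abs_le.1 (abs_cos_mul_sinIntegral_le (x * u)
    (v := (2 * x + δ) * u) (by positivity))
  have s4 := abs_le.1 (abs_cos_mul_sinIntegral_le (x * u)
    (v := (2 * x - δ) * u) (mul_nonneg (by linarith) hu.le))
  have c1 := abs_le.1 (abs_sin_mul_cosTail_le hcoTail hxu le_rfl)
  have c2 := abs_le.1 (abs_sin_mul_cosTail_le hcoTail hxu
    (v := (2 * x + δ) * u) (by nlinarith))
  have c3 := abs_le.1 (abs_sin_mul_cosTail_le hcoTail hxu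
    (v := (2 * x - δ) * u) (by nlinarith))
  rw [abs_le]
  constructor <;> linarith [s1.1, s1.2, s2.1, s2.2, s3.1, s3.2, s4.1, s4.2, c1.1, c1.2,
    c2.1, c2.2, c3.1, c3.2]

theorem tendsto_truncatedKernel {coTail : ℝ → ℝ} (hcoTail : IsCosTail coTail) {x u : ℝ}
    (hx : 0 < x) (hu : 0 < u) :
    Tendsto (fun δ => truncatedKernel x δ u) (nhdsWithin 0 (Ioi 0))
      (nhds (x⁻¹ * (sin (x * u) * coTail (x * u) + cos (x * u) * sinIntegral (x * u)))) := by
  have h2 : (0 : ℝ) < 2 * x * u := by positivity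
  have hS : ∀ l : ℝ → ℝ, Continuous l →
      Tendsto (fun δ => sinIntegral (l δ)) (nhdsWithin 0 (Ioi 0)) (nhds (sinIntegral (l 0))) :=
    fun l hl => (continuous_sinIntegral.comp hl).continuousWithinAt
  have hC : ∀ l : ℝ → ℝ, Continuous l → l 0 = 2 * x * u →
      Tendsto (fun δ => coTail (l δ)) (nhdsWithin 0 (Ioi 0)) (nhds (coTail (2 * x * u))) :=
    fun l hl h0 => by
      have hc : ContinuousAt coTail (l 0) :=
        (continuousOn_cosTail hcoTail).continuousAt (Ioi_mem_nhds (h0 ▸ h2))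
      rw [← h0]
      exact (hc.comp hl.continuousAt).tendsto.mono_left nhdsWithin_le_nhds
  have hlim := ((((((tendsto_const_nhds (x := 2 * sinIntegral (x * u))).sub
    ((hS (fun δ => δ * u) (by fun_prop)).const_mul 2)).add
    (hS (fun δ => (2 * x + δ) * u) (by fun_prop))).sub
    (hS (fun δ => (2 * x - δ) * u) (by fun_prop))).const_mul (cos (x * u))).add
    ((((tendsto_const_nhds (x := 2 * coTail (x * u))).add
    (hC (fun δ => (2 * x + δ) * u) (by fun_prop) (by ring))).sub
    (hC (fun δ => (2 * x - δ) * u) (by fun_prop) (by ring))).const_mul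
      (sin (x * u)))).const_mul (2 * x)⁻¹
  have hval : x⁻¹ * (sin (x * u) * coTail (x * u) + cos (x * u) * sinIntegral (x * u)) =
      (2 * x)⁻¹ * (cos (x * u) * (2 * sinIntegral (x * u) - 2 * sinIntegral (0 * u) +
        sinIntegral ((2 * x + 0) * u) - sinIntegral ((2 * x - 0) * u)) +
        sin (x * u) * (2 * coTail (x * u) + coTail (2 * x * u) - coTail (2 * x * u))) := by
    have h0 : sinIntegral 0 = 0 := intervalIntegral.integral_same
    rw [zero_mul, h0, add_zero, sub_zero, mul_inv]
    ring
  rw [hval]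
  refine hlim.congr' ?_
  filter_upwards [Ioo_mem_nhdsGT hx] with δ hδ
  exact (truncatedKernel_eq hcoTail hδ.1 hδ.2 hu).symm

theorem integrable_prod_sin_mul_inv {f' : ℝ → ℂ} (hf' : IntegrableOn f' (Ioi 0)) {x δ : ℝ}
    (hδ : 0 < δ) (hδx : δ < x) :
    Integrable (Function.uncurry fun t u : ℝ =>
        ((sin (t * u) : ℝ) : ℂ) * ((((t ^ 2 - x ^ 2)⁻¹ : ℝ) : ℂ) * f' u))
      ((volume.restrict {t : ℝ | 0 < t ∧ δ < |t - x|}).prod (volume.restrict (Ioi 0))) := by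
  have h := (integrableOn_inv_sq_sub_sq hδ hδx).ofReal (𝕜 := ℂ)
  refine (h.mul_prod hf').bdd_mul (c := 1) (Measurable.aestronglyMeasurable (by fun_prop))
    (ae_of_all _ fun z => ?_)
  rw [Complex.norm_real]
  exact abs_sin_le_one _

theorem setIntegral_sin_mul_inv_mul (x δ u : ℝ) (c : ℂ) :
    ∫ t in {t : ℝ | 0 < t ∧ δ < |t - x|},
        ((sin (t * u) : ℝ) : ℂ) * ((((t ^ 2 - x ^ 2)⁻¹ : ℝ) : ℂ) * c) =
      (truncatedKernel x δ u : ℂ) * c := by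
  rw [truncatedKernel, ← integral_complex_ofReal, ← integral_mul_const]
  simp only [Complex.ofReal_mul, mul_assoc]

theorem setIntegral_hilbert_eq {f' : ℝ → ℂ} (hf' : IntegrableOn f' (Ioi 0)) {x δ : ℝ}
    (hδ : 0 < δ) (hδx : δ < x) :
    ∫ t in {t : ℝ | 0 < t ∧ δ < |t - x|},
        (t : ℂ) * ((∫ u in Ioi (0 : ℝ), f' u * (sin (t * u) : ℂ)) / (t : ℂ)) /
          ((t : ℂ) ^ 2 - (x : ℂ) ^ 2) =
      ∫ u in Ioi (0 : ℝ), (truncatedKernel x δ u : ℂ) * f' u := by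
  have hswap := integral_integral_swap (integrable_prod_sin_mul_inv hf' hδ hδx)
  simp only [setIntegral_sin_mul_inv_mul] at hswap
  rw [← hswap]
  have hmeas : MeasurableSet {t : ℝ | 0 < t ∧ δ < |t - x|} := by
    rw [setOf_pos_and_lt_abs_sub hδ hδx]
    exact measurableSet_Ioo.union measurableSet_Ioi
  refine setIntegral_congr_fun hmeas fun t ht => ?_
  have ht0 : (t : ℂ) ≠ 0 := Complex.ofReal_ne_zero.2 ht.1.ne'
  rw [mul_div_cancel₀ _ ht0, div_eq_mul_inv, ← integral_mul_const]
  congr 1 with u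
  push_cast
  ring

/-- **Lemma 1.** If `f : (0,∞) → ℂ` is locally absolutely continuous (with derivative
`f'`), of bounded variation, and tends to `0` at infinity (so `f'` is integrable on
`(0,∞)`), then for every `x > 0`,
`H₀(T_{f'})(x) = (2/(xπ)) ∫_0^∞ f'(t) sin(xt) (∫_{xt}^∞ cos v / v dv) dt
  + (2/(xπ)) ∫_0^∞ f'(t) cos(xt) (∫_0^{xt} sin v / v dv) dt`,
where `T_{f'}(u) = f̂'_s(u)/u` and `H₀` is the odd Hilbert transform. -/
theorem hilbert_of_T_transform_formula (f f' H0T : ℝ → ℂ) (coTail : ℝ → ℝ)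
    -- local absolute continuity on (0,∞) with derivative f'
    (hac : ∀ a b : ℝ, 0 < a → a ≤ b → f b - f a = ∫ t in a..b, f' t)
    -- bounded variation on (0,∞)
    (hbv : BoundedVariationOn f (Set.Ioi 0))
    -- vanishing at infinity
    (hlim : Filter.Tendsto f Filter.atTop (nhds 0))
    -- f' is Lebesgue integrable on (0,∞)
    (hf' : MeasureTheory.IntegrableOn f' (Set.Ioi 0))
    -- H0T is the odd Hilbert transform (principal value) of T_{f'}(u) = f̂'_s(u)/u
    (hH0T : ∀ x : ℝ, 0 < x →
      Filter.Tendsto (fun δ : ℝ =>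
          ((2 / Real.pi : ℝ) : ℂ) *
            ∫ t in {t : ℝ | 0 < t ∧ δ < |t - x|},
              (t : ℂ) *
                  ((∫ u in Set.Ioi (0 : ℝ), f' u * (Real.sin (t * u) : ℂ)) / (t : ℂ)) /
                ((t : ℂ) ^ 2 - (x : ℂ) ^ 2))
        (nhdsWithin 0 (Set.Ioi 0)) (nhds (H0T x)))
    -- coTail u = ∫_u^∞ cos v / v dv, as an improper Riemann integral
    (hcoTail : ∀ u : ℝ, 0 < u →
      Filter.Tendsto (fun A : ℝ => ∫ v in u..A, Real.cos v / v)
        Filter.atTop (nhds (coTail u))) :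
    ∀ x : ℝ, 0 < x →
      H0T x =
        ((2 / (x * Real.pi) : ℝ) : ℂ) *
            (∫ t in Set.Ioi (0 : ℝ),
              f' t * (Real.sin (x * t) : ℂ) * ((coTail (x * t) : ℝ) : ℂ)) +
          ((2 / (x * Real.pi) : ℝ) : ℂ) *
            ∫ t in Set.Ioi (0 : ℝ),
              f' t * (Real.cos (x * t) : ℂ) *
                ((∫ v in (0 : ℝ)..(x * t), Real.sin v / v : ℝ) : ℂ) := by
  intro x hx
  have hcT : IsCosTail coTail := hcoTail
  have hker : Tendsto (fun δ => ∫ u in Ioi (0 : ℝ), (truncatedKernel x δ u : ℂ) * f' u)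
      (nhdsWithin 0 (Ioi 0)) (nhds (∫ u in Ioi (0 : ℝ),
        ((x⁻¹ * (sin (x * u) * coTail (x * u) + cos (x * u) * sinIntegral (x * u)) : ℝ) : ℂ) *
          f' u)) := by
    refine tendsto_integral_filter_of_dominated_convergence
      (fun u => (2 * x)⁻¹ * 26 * ‖f' u‖) ?_ ?_ (hf'.norm.const_mul _) ?_
    · filter_upwards [Ioo_mem_nhdsGT hx] with δ hδ
      have h := (integrable_prod_sin_mul_inv hf' hδ.1 hδ.2).integral_prod_right
      simp only [Function.uncurry, setIntegral_sin_mul_inv_mul] at h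
      exact h.aestronglyMeasurable
    · filter_upwards [Ioo_mem_nhdsGT hx] with δ hδ
      filter_upwards [ae_restrict_mem measurableSet_Ioi] with u hu
      rw [norm_mul, Complex.norm_real]
      exact mul_le_mul_of_nonneg_right (abs_truncatedKernel_le hcT hδ.1 hδ.2 hu)
        (norm_nonneg _)
    · filter_upwards [ae_restrict_mem measurableSet_Ioi] with u hu
      exact ((Complex.continuous_ofReal.tendsto _).comp
        (tendsto_truncatedKernel hcT hx hu)).mul_const _
  have hH := tendsto_nhds_unique (hH0T x hx) ((hker.const_mul ((2 / π : ℝ) : ℂ)).congr' (by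
    filter_upwards [Ioo_mem_nhdsGT hx] with δ hδ
    rw [setIntegral_hilbert_eq hf' hδ.1 hδ.2]))
  have hsinInt : IntegrableOn (fun t => f' t * (sin (x * t) : ℂ) * ((coTail (x * t) : ℝ) : ℂ))
      (Ioi 0) := by
    have hc : ContinuousOn (fun t => sin (x * t) * coTail (x * t)) (Ioi 0) :=
      ContinuousOn.mul (by fun_prop) ((continuousOn_cosTail hcT).comp
        (by fun_prop) fun t ht => mul_pos hx ht)
    have h := Integrable.mul_bdd (c := 2) hf'
      (Complex.continuous_ofReal.comp_continuousOn hc |>.aestronglyMeasurable measurableSet_Ioi)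
      (by
        filter_upwards [ae_restrict_mem measurableSet_Ioi] with t ht
        rw [Function.comp_apply, Complex.norm_real]
        exact abs_sin_mul_cosTail_le hcT (mul_pos hx ht) le_rfl)
    refine h.congr (ae_of_all _ fun t => ?_)
    simp only [Function.comp_apply, Complex.ofReal_mul, mul_assoc]
  have hcosInt : IntegrableOn (fun t => f' t * (cos (x * t) : ℂ) *
      ((∫ v in (0 : ℝ)..(x * t), sin v / v : ℝ) : ℂ)) (Ioi 0) := by
    have hc : Continuous (fun t => cos (x * t) * sinIntegral (x * t)) :=
      Continuous.mul (by fun_prop) (continuous_sinIntegral.comp (by fun_prop))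
    have h := Integrable.mul_bdd (c := 3) hf'
      (Complex.continuous_ofReal.comp hc).aestronglyMeasurable
      (by
        filter_upwards [ae_restrict_mem measurableSet_Ioi] with t ht
        rw [Function.comp_apply, Complex.norm_real]
        exact abs_cos_mul_sinIntegral_le _ (mul_pos hx ht).le)
    refine h.congr (ae_of_all _ fun t => ?_)
    simp only [Function.comp_apply, Complex.ofReal_mul, mul_assoc, sinIntegral]
  rw [hH, ← mul_add, ← integral_add hsinInt hcosInt, ← integral_const_mul, ← integral_const_mul]
  congr 1 with t
  rw [sinIntegral]
  push_cast
  rw [div_mul_eq_div_div]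
  ring
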